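/- arXiv:2203.12062 — 3 statements merged into one kernel-verified Lean document; each statement's English description precedes it below -/
import Mathlib

section
/- Let p be a probability mass function on Fin M with p j > 0 for every j, let C : Fin M → ℝ, and let α ∈ (0,1). Then the supremum of ∑ j, q j · C j over all probability mass functions q on Fin M with d_TV(p,q) ≤ α equals α · (max over j of C j) + (1 − α) · CVaR_{1−α}(C). (Dual representation of the total-variation-distance risk measure TVD_{1−α}.) -/
open Finset

/-- `CVaR p C β` is CVaR_{1−β} of the cost `C` under the pmf `p`. -/
noncomputable def CVaR {M : ℕ} (p C : Fin M → ℝ) (β : ℝ) : ℝ :=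
  ⨅ z : ℝ, z + (1 / (1 - β)) * ∑ j, p j * max (C j - z) 0

lemma exists_quantile {ι : Type*} [Fintype ι] (p C : ι → ℝ) (α : ℝ) (hα : α ∈ Set.Ioo (0 : ℝ) 1)
    (hp1 : ∑ j, p j = 1) :
    ∃ k, ∑ j with C j < C k, p j ≤ α ∧ α ≤ ∑ j with C j ≤ C k, p j := by
  have hne : (univ : Finset ι).Nonempty := by
    by_contra h
    rw [not_nonempty_iff_eq_empty] at h
    simp [h] at hp1
  obtain ⟨t, -, ht⟩ := exists_max_image univ C hne
  have hS : (univ.filter fun k => α ≤ ∑ j with C j ≤ C k, p j).Nonempty := by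
    refine ⟨t, mem_filter.2 ⟨mem_univ _, ?_⟩⟩
    rw [filter_true_of_mem fun j _ => ht j (mem_univ j), hp1]
    exact hα.2.le
  obtain ⟨k, hk, hmin⟩ := exists_min_image _ C hS
  refine ⟨k, ?_, (mem_filter.1 hk).2⟩
  rcases (univ.filter fun j => C j < C k).eq_empty_or_nonempty with h | h
  · rw [h, sum_empty]
    exact hα.1.le
  · obtain ⟨i, hi, hmax⟩ := exists_max_image _ C h
    have hik : C i < C k := (mem_filter.1 hi).2
    have heq : (univ.filter fun j => C j < C k) = univ.filter fun j => C j ≤ C i := by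
      ext j
      simp only [mem_filter, mem_univ, true_and]
      exact ⟨fun hj => hmax j (by simpa using hj), fun hj => hj.trans_lt hik⟩
    rw [heq]
    by_contra! hlt
    exact absurd (hmin i (by simpa using hlt.le)) (not_le.2 hik)

/-- Removing mass `α` from the lowest values of `C` leaves a measure concentrated on the upper
tail of `C`. -/
lemma exists_upper_tail {ι : Type*} [Fintype ι] (p C : ι → ℝ) (α : ℝ)
    (hα : α ∈ Set.Ioo (0 : ℝ) 1) (hp0 : ∀ j, 0 < p j) (hp1 : ∑ j, p j = 1) :
    ∃ (z : ℝ) (m : ι → ℝ), (∀ j, 0 ≤ m j) ∧ (∀ j, m j ≤ p j) ∧ ∑ j, m j = 1 - α ∧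
      ∀ j, m j * (C j - z) = p j * max (C j - z) 0 := by
  obtain ⟨k, hlt, hle⟩ := exists_quantile p C α hα hp1
  have hsplit : ∑ j with C j ≤ C k, p j = ∑ j with C j < C k, p j + ∑ j with C j = C k, p j := by
    simp only [sum_filter, ← sum_add_distrib]
    refine sum_congr rfl fun j _ => ?_
    rcases lt_trichotomy (C j) (C k) with h | h | h
    · simp [h, h.le, h.ne]
    · simp [h]
    · simp [h.not_ge, h.not_gt, h.ne']
  set a := ∑ j with C j < C k, p j
  set e := ∑ j with C j = C k, p j with he
  have hepos : 0 < e := sum_pos (fun j _ => hp0 j) ⟨k, by simp⟩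
  set r := (a + e - α) / e with hr
  have hr0 : 0 ≤ r := div_nonneg (by linarith) hepos.le
  have hr1 : r ≤ 1 := by rw [hr, div_le_one hepos]; linarith
  have hre : r * e = a + e - α := div_mul_cancel₀ _ hepos.ne'
  refine ⟨C k, fun j => if C j < C k then 0 else if C j = C k then r * p j else p j,
    fun j => ?_, fun j => ?_, ?_, fun j => ?_⟩
  · have := hp0 j
    dsimp only
    split_ifs <;> positivity
  · have := hp0 j
    dsimp only
    split_ifs <;> nlinarith
  · have hm : ∀ j, (if C j < C k then 0 else if C j = C k then r * p j else p j) =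
        p j - (if C j < C k then p j else 0) - (1 - r) * (if C j = C k then p j else 0) := by
      intro j
      rcases lt_trichotomy (C j) (C k) with h | h | h
      · simp [h, h.ne]
      · simp [h]; ring
      · simp [h.not_gt, h.ne']
    simp only [hm, sum_sub_distrib, ← mul_sum, ← sum_filter, hp1]
    change 1 - a - (1 - r) * e = 1 - α
    linarith
  · rcases lt_trichotomy (C j) (C k) with h | h | h
    · simp [h, h.le]
    · simp [h]
    · simp [h.not_gt, h.ne', h.le]

lemma sum_mul_le_of_tv_le {ι : Type*} [Fintype ι] {p q C : ι → ℝ} {α b : ℝ}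
    (hα1 : α ≤ 1) (hp0 : ∀ j, 0 ≤ p j) (hp1 : ∑ j, p j = 1) (hq0 : ∀ j, 0 ≤ q j)
    (hq1 : ∑ j, q j = 1) (hpq : (1 / 2) * ∑ j, |p j - q j| ≤ α) (hb : ∀ j, C j ≤ b) (z : ℝ) :
    ∑ j, q j * C j ≤ α * b + (1 - α) * z + ∑ j, p j * max (C j - z) 0 := by
  rcases le_total z b with hz | hz
  · have hmin : ∀ j, min (p j) (q j) = (1 / 2) * (p j + q j - |p j - q j|) := by
      intro j
      rcases le_total (p j) (q j) with h | h
      · rw [min_eq_left h, abs_of_nonpos (by linarith)]; ring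
      · rw [min_eq_right h, abs_of_nonneg (by linarith)]; ring
    have hs : ∑ j, min (p j) (q j) = 1 - (1 / 2) * ∑ j, |p j - q j| := by
      simp only [hmin]
      rw [← mul_sum, sum_sub_distrib, sum_add_distrib, hp1, hq1]
      ring
    have hpt : ∀ j, q j * C j ≤
        q j * b - min (p j) (q j) * (b - z) + p j * max (C j - z) 0 := by
      intro j
      have h1 : (q j - min (p j) (q j)) * C j ≤ (q j - min (p j) (q j)) * b :=
        mul_le_mul_of_nonneg_left (hb j) (sub_nonneg.2 (min_le_right _ _))
      have h2 : min (p j) (q j) * (C j - z) ≤ min (p j) (q j) * max (C j - z) 0 :=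
        mul_le_mul_of_nonneg_left (le_max_left _ _) (le_min (hp0 j) (hq0 j))
      have h3 : min (p j) (q j) * max (C j - z) 0 ≤ p j * max (C j - z) 0 :=
        mul_le_mul_of_nonneg_right (min_le_left _ _) (le_max_right _ _)
      linarith
    have hsum := sum_le_sum fun j (_ : j ∈ univ) => hpt j
    rw [sum_add_distrib, sum_sub_distrib, ← sum_mul, ← sum_mul, hq1, hs] at hsum
    nlinarith [mul_nonneg (sub_nonneg.2 hpq) (sub_nonneg.2 hz)]
  · have h1 : ∑ j, q j * C j ≤ b := by
      calc ∑ j, q j * C j ≤ ∑ j, q j * b :=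
            sum_le_sum fun j _ => mul_le_mul_of_nonneg_left (hb j) (hq0 j)
        _ = b := by rw [← sum_mul, hq1, one_mul]
    have h2 : 0 ≤ ∑ j, p j * max (C j - z) 0 :=
      sum_nonneg fun j _ => mul_nonneg (hp0 j) (le_max_right _ _)
    nlinarith [mul_nonneg (sub_nonneg.2 hα1) (sub_nonneg.2 hz)]

/-- dual representation of the TVD risk measure. -/
theorem tvd_risk_dual (M : ℕ) (p C : Fin M → ℝ) (α : ℝ)
    (hα : α ∈ Set.Ioo (0 : ℝ) 1)
    (hp0 : ∀ j, 0 < p j) (hp1 : ∑ j, p j = 1) :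
    sSup {v : ℝ | ∃ q : Fin M → ℝ, (∀ j, 0 ≤ q j) ∧ (∑ j, q j = 1) ∧
        (1 / 2) * ∑ j, |p j - q j| ≤ α ∧ v = ∑ j, q j * C j} =
      α * (⨆ j, C j) + (1 - α) * CVaR p C α := by
  have hα1 : 0 < 1 - α := sub_pos.2 hα.2
  have hM : Nonempty (Fin M) := by
    by_contra h
    rw [not_nonempty_iff] at h
    simp at hp1
  have hb : ∀ j, C j ≤ ⨆ j, C j := le_ciSup (Set.finite_range C).bddAbove
  obtain ⟨t, ht⟩ := exists_eq_ciSup_of_finite (f := C)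
  set b := ⨆ j, C j
  set f : ℝ → ℝ := fun z => z + (1 / (1 - α)) * ∑ j, p j * max (C j - z) 0 with hf
  have hmul : ∀ z, (1 - α) * f z = (1 - α) * z + ∑ j, p j * max (C j - z) 0 := by
    intro z
    simp only [hf]
    field_simp
  have hle_f : ∀ q : Fin M → ℝ, (∀ j, 0 ≤ q j) → ∑ j, q j = 1 →
      (1 / 2) * ∑ j, |p j - q j| ≤ α → ∀ z, (∑ j, q j * C j - α * b) / (1 - α) ≤ f z := by
    intro q hq0 hq1 hpq z
    rw [div_le_iff₀' hα1, hmul]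
    linarith [sum_mul_le_of_tv_le hα.2.le (fun j => (hp0 j).le) hp1 hq0 hq1 hpq hb z]
  have hbdd : BddBelow (Set.range f) := by
    refine ⟨_, Set.forall_mem_range.2 (hle_f p (fun j => (hp0 j).le) hp1 ?_)⟩
    simpa using hα.1.le
  have hle : ∀ q : Fin M → ℝ, (∀ j, 0 ≤ q j) → ∑ j, q j = 1 →
      (1 / 2) * ∑ j, |p j - q j| ≤ α → ∑ j, q j * C j ≤ α * b + (1 - α) * CVaR p C α := by
    intro q hq0 hq1 hpq
    have h := le_ciInf (hle_f q hq0 hq1 hpq)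
    rw [div_le_iff₀' hα1] at h
    change _ ≤ (1 - α) * CVaR p C α at h
    linarith
  refine IsGreatest.csSup_eq ⟨?_, ?_⟩
  · obtain ⟨z, m, hm0, hmp, hm1, hmz⟩ := exists_upper_tail p C α hα hp0 hp1
    have hsg : ∀ j, 0 ≤ Pi.single (M := fun _ => ℝ) t α j := by
      intro j
      rw [Pi.single_apply]
      split_ifs
      exacts [hα.1.le, le_rfl]
    have hq0 : ∀ j, 0 ≤ m j + Pi.single (M := fun _ => ℝ) t α j := fun j =>
      add_nonneg (hm0 j) (hsg j)
    have hq1 : ∑ j, (m j + Pi.single (M := fun _ => ℝ) t α j) = 1 := by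
      rw [sum_add_distrib, hm1, sum_pi_single']
      simp
    have hpq : (1 / 2) * ∑ j, |p j - (m j + Pi.single (M := fun _ => ℝ) t α j)| ≤ α := by
      have h : ∑ j, |p j - (m j + Pi.single (M := fun _ => ℝ) t α j)| ≤
          ∑ j, (p j - m j + Pi.single (M := fun _ => ℝ) t α j) := by
        refine sum_le_sum fun j _ => ?_
        have := hmp j
        have : 0 ≤ Pi.single (M := fun _ => ℝ) t α j := hsg j
        rw [abs_le]
        constructor <;> linarith
      rw [sum_add_distrib, sum_sub_distrib, hp1, hm1, sum_pi_single'] at h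
      simp only [mem_univ, if_true] at h
      linarith
    refine ⟨_, hq0, hq1, hpq, le_antisymm ?_ (hle _ hq0 hq1 hpq)⟩
    have hval : ∑ j, (m j + Pi.single (M := fun _ => ℝ) t α j) * C j =
        α * b + (1 - α) * f z := by
      have hmC : ∑ j, m j * C j = (1 - α) * z + ∑ j, p j * max (C j - z) 0 := by
        simp only [← hmz, mul_sub, sum_sub_distrib, ← sum_mul, hm1]
        ring
      have hs : ∑ j, Pi.single (M := fun _ => ℝ) t α j * C j = α * b := by
        simp [Pi.single_apply, ht]
      simp only [add_mul, sum_add_distrib]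
      rw [hmC, hs, hmul]
      ring
    have hinf : CVaR p C α ≤ f z := ciInf_le hbdd z
    rw [hval]
    gcongr
  · rintro _ ⟨q, hq0, hq1, hpq, rfl⟩
    exact hle q hq0 hq1 hpq
end

section
/- Let p be a probability mass function on Fin M, let C : Fin M → ℝ, and let β ∈ (0,1). Then CVaR_{1−β}(C) equals the minimum, over z ∈ ℝ and s : Fin M → ℝ satisfying s j ≥ 0 and s j + z ≥ C j for all j, of ∑ j, p j · ( z + s j / (1 − β) ); moreover this minimum is attained. (Linear-programming representation of CVaR.) -/
open Finset

/-- The Rockafellar–Uryasev objective, whose infimum is `CVaR`, attains its minimum. -/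
theorem exists_forall_cvar_objective_le {M : ℕ} (p C : Fin M → ℝ) (β : ℝ)
    (hβ : β ∈ Set.Ioo (0 : ℝ) 1) (hp0 : ∀ j, 0 ≤ p j) (hp1 : ∑ j, p j = 1) :
    ∃ z₀ : ℝ, ∀ z : ℝ, z₀ + (1 / (1 - β)) * ∑ j, p j * max (C j - z₀) 0 ≤
      z + (1 / (1 - β)) * ∑ j, p j * max (C j - z) 0 := by
  obtain ⟨hβ0, hβ1⟩ := hβ
  have hk0 : 0 < 1 / (1 - β) := one_div_pos.2 (sub_pos.2 hβ1)
  have hk1 : 1 < 1 / (1 - β) := (one_lt_div (sub_pos.2 hβ1)).2 (by linarith)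
  refine Continuous.exists_forall_le
    (f := fun z : ℝ => z + (1 / (1 - β)) * ∑ j, p j * max (C j - z) 0) (by fun_prop) ?_
  rw [cocompact_eq_atBot_atTop, Filter.tendsto_sup]
  constructor
  · have hlim : Filter.Tendsto
        (fun z : ℝ => 1 / (1 - β) * ∑ j, p j * C j + (1 / (1 - β) - 1) * -z)
        Filter.atBot Filter.atTop :=
      Filter.tendsto_atTop_add_const_left _ _
        (Filter.tendsto_neg_atBot_atTop.const_mul_atTop (sub_pos.2 hk1))
    refine Filter.tendsto_atTop_mono (fun z => ?_) hlim
    have hmean : ∑ j, p j * C j - z ≤ ∑ j, p j * max (C j - z) 0 := by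
      calc ∑ j, p j * C j - z = ∑ j, p j * (C j - z) := by
            simp only [mul_sub, sum_sub_distrib, ← sum_mul, hp1, one_mul]
        _ ≤ _ := sum_le_sum fun j _ => mul_le_mul_of_nonneg_left (le_max_left _ _) (hp0 j)
    have := mul_le_mul_of_nonneg_left hmean hk0.le
    linarith
  · refine Filter.tendsto_atTop_mono (fun z => ?_) Filter.tendsto_id
    exact le_add_of_nonneg_right (mul_nonneg hk0.le
      (sum_nonneg fun j _ => mul_nonneg (hp0 j) (le_max_right _ _)))

/-- The linear-programming objective, rewritten in the form used to define `CVaR`. -/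
theorem sum_mul_add_div_eq {M : ℕ} (p s : Fin M → ℝ) (β z : ℝ) (hp1 : ∑ j, p j = 1) :
    ∑ j, p j * (z + s j / (1 - β)) = z + (1 / (1 - β)) * ∑ j, p j * s j := by
  simp only [mul_add, sum_add_distrib, ← sum_mul, hp1, one_mul, mul_sum]
  congr 1
  exact sum_congr rfl fun j _ => by ring

/-- linear-programming representation of CVaR (minimum attained). -/
theorem cvar_lp_representation (M : ℕ) (p C : Fin M → ℝ) (β : ℝ)
    (hβ : β ∈ Set.Ioo (0 : ℝ) 1)
    (hp0 : ∀ j, 0 ≤ p j) (hp1 : ∑ j, p j = 1) :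
    IsLeast {v : ℝ | ∃ (z : ℝ) (s : Fin M → ℝ),
        (∀ j, 0 ≤ s j) ∧ (∀ j, C j ≤ s j + z) ∧
        v = ∑ j, p j * (z + s j / (1 - β))} (CVaR p C β) := by
  obtain ⟨z₀, hz₀⟩ := exists_forall_cvar_objective_le p C β hβ hp0 hp1
  have hmin : CVaR p C β = z₀ + (1 / (1 - β)) * ∑ j, p j * max (C j - z₀) 0 :=
    le_antisymm (ciInf_le ⟨_, Set.forall_mem_range.2 hz₀⟩ z₀) (le_ciInf hz₀)
  rw [hmin]
  constructor
  · refine ⟨z₀, fun j => max (C j - z₀) 0, fun j => le_max_right _ _,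
      fun j => sub_le_iff_le_add.1 (le_max_left _ _), ?_⟩
    rw [sum_mul_add_div_eq p _ β z₀ hp1]
  · rintro v ⟨z, s, hs0, hsC, rfl⟩
    rw [sum_mul_add_div_eq p s β z hp1]
    refine (hz₀ z).trans ?_
    have hk0 : 0 ≤ 1 / (1 - β) := one_div_nonneg.2 (sub_nonneg.2 hβ.2.le)
    gcongr with j
    · exact hp0 j
    · exact max_le (sub_le_iff_le_add.2 (hsC j)) (hs0 j)
end

section
/- Let p be a probability mass function on Fin M, let C, C' : Fin M → ℝ, and let β ∈ (0,1). Then CVaR_{1−β}(j ↦ C j + C' j) ≤ CVaR_{1−β}(C) + CVaR_{1−β}(C'). (Subadditivity of CVaR on a finite probability space.) -/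
open Finset

theorem sum_mul_le_add_mul_sum_max {M : ℕ} {p : Fin M → ℝ} (C : Fin M → ℝ) {k : ℝ} (hk : 1 ≤ k)
    (hp0 : ∀ j, 0 ≤ p j) (hp1 : ∑ j, p j = 1) (z : ℝ) :
    ∑ j, p j * C j ≤ z + k * ∑ j, p j * max (C j - z) 0 := by
  have hnonneg : 0 ≤ ∑ j, p j * max (C j - z) 0 :=
    sum_nonneg fun j _ => mul_nonneg (hp0 j) (le_max_right _ _)
  have hle : ∑ j, p j * (C j - z) ≤ ∑ j, p j * max (C j - z) 0 :=
    sum_le_sum fun j _ => mul_le_mul_of_nonneg_left (le_max_left _ _) (hp0 j)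
  have heq : ∑ j, p j * (C j - z) = ∑ j, p j * C j - z := by
    simp only [mul_sub, sum_sub_distrib, ← sum_mul, hp1, one_mul]
  nlinarith

theorem CVaR_le {M : ℕ} {p : Fin M → ℝ} (C : Fin M → ℝ) {β : ℝ} (hβ : β ∈ Set.Ioo (0 : ℝ) 1)
    (hp0 : ∀ j, 0 ≤ p j) (hp1 : ∑ j, p j = 1) (z : ℝ) :
    CVaR p C β ≤ z + (1 / (1 - β)) * ∑ j, p j * max (C j - z) 0 := by
  have hk : 1 ≤ 1 / (1 - β) := by
    rw [le_div_iff₀ (by linarith [hβ.2])]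
    linarith [hβ.1]
  refine ciInf_le ⟨∑ j, p j * C j, ?_⟩ z
  rintro _ ⟨w, rfl⟩
  exact sum_mul_le_add_mul_sum_max C hk hp0 hp1 w

/-- subadditivity of CVaR on a finite probability space. -/
theorem cvar_subadditive (M : ℕ) (p C C' : Fin M → ℝ) (β : ℝ)
    (hβ : β ∈ Set.Ioo (0 : ℝ) 1)
    (hp0 : ∀ j, 0 ≤ p j) (hp1 : ∑ j, p j = 1) :
    CVaR p (fun j => C j + C' j) β ≤ CVaR p C β + CVaR p C' β := by
  refine le_ciInf_add_ciInf fun z w => (CVaR_le _ hβ hp0 hp1 (z + w)).trans ?_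
  have hk : 0 ≤ 1 / (1 - β) := one_div_nonneg.2 (by linarith [hβ.2])
  have hsum : ∑ j, p j * max (C j + C' j - (z + w)) 0 ≤
      ∑ j, p j * max (C j - z) 0 + ∑ j, p j * max (C' j - w) 0 := by
    rw [← sum_add_distrib]
    refine sum_le_sum fun j _ => ?_
    rw [← mul_add]
    refine mul_le_mul_of_nonneg_left (max_le ?_ ?_) (hp0 j)
    · linarith [le_max_left (C j - z) 0, le_max_left (C' j - w) 0]
    · exact add_nonneg (le_max_right _ _) (le_max_right _ _)
  linarith [mul_le_mul_of_nonneg_left hsum hk]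
end
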